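/- arXiv:1003.4605 — 6 statements merged into one kernel-verified Lean document; each statement's English description precedes it below -/
import Mathlib

section
/- Let d ≥ 0 be an integer and let (a_ν, b_ν), ν ≥ 1, be a sequence in ℝ² converging to a point (a,b) ∈ ℝ² with (a,b) ≠ (0,−1). Suppose that for every ν there exist sums of squares s_ν, t_ν in ℝ[x] of degree ≤ 2d with 1 = (x² + a_ν x + b_ν)·t_ν(x) − (x² − 1)·s_ν(x). Then there exist sums of squares s, t in ℝ[x] of degree ≤ 2d with 1 = (x² + ax + b)·t(x) − (x² − 1)·s(x); in particular (a,b) does not lie in P'. -/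
open Polynomial

noncomputable section

/-- A univariate real polynomial is a sum of squares. -/
def IsSosPoly (p : Polynomial ℝ) : Prop :=
  ∃ (r : ℕ) (g : Fin r → Polynomial ℝ), p = ∑ i, g i ^ 2

/-- The boundary set `P'` of the closure of the parameter set `P`. -/
def Pbdry : Set (ℝ × ℝ) :=
  {p | (p.1 ^ 2 = 4 * p.2 ∧ 4 ≤ p.1 ^ 2) ∨ (|p.1| = p.2 + 1 ∧ |p.1| ≤ 2)}

/-- The squares in a sum of squares of degree at most `2 * d` have degree at most `d`. -/
theorem natDegree_le_of_natDegree_sum_sq_le {ι : Type*} [Fintype ι] {g : ι → ℝ[X]} {d : ℕ}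
    (h : (∑ i, g i ^ 2).natDegree ≤ 2 * d) (i : ι) : (g i).natDegree ≤ d := by
  by_contra! hi
  obtain ⟨j, -, hj⟩ := Finset.exists_max_image Finset.univ (fun i => (g i).natDegree)
    ⟨i, Finset.mem_univ i⟩
  have hdj : d < (g j).natDegree := hi.trans_le (hj i (Finset.mem_univ i))
  have hcoeff : (∑ i, g i ^ 2).coeff (2 * (g j).natDegree) = 0 :=
    coeff_eq_zero_of_natDegree_lt (by lia)
  rw [finsetSum_coeff, Finset.sum_congr rfl fun k hk => coeff_pow_of_natDegree_le (hj k hk),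
    Finset.sum_eq_zero_iff_of_nonneg fun k _ => sq_nonneg _] at hcoeff
  have hlead : (g j).leadingCoeff = 0 := pow_eq_zero_iff two_ne_zero |>.1 <|
    hcoeff j (Finset.mem_univ j)
  rw [leadingCoeff_eq_zero.1 hlead, natDegree_zero] at hdj
  exact Nat.not_lt_zero _ hdj

theorem IsSosPoly.eval_nonneg {p : ℝ[X]} (hp : IsSosPoly p) (x : ℝ) : 0 ≤ p.eval x := by
  obtain ⟨r, g, rfl⟩ := hp
  rw [eval_finsetSum]
  exact Finset.sum_nonneg fun i _ => by rw [eval_pow]; positivity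

/-- The polynomial `∑ j k, G j k * L j * L k` with Gram matrix `G` with respect to `L`. -/
def gramPoly {n : ℕ} (L : Fin n → ℝ[X]) (G : Matrix (Fin n) (Fin n) ℝ) : ℝ[X] :=
  ∑ j, ∑ k, C (G j k) * (L j * L k)

theorem gramPoly_conjTranspose_mul_self {m n : ℕ} (L : Fin n → ℝ[X])
    (A : Matrix (Fin m) (Fin n) ℝ) :
    gramPoly L (A.conjTranspose * A) = ∑ i, (∑ j, C (A i j) * L j) ^ 2 := by
  simp only [gramPoly, Matrix.mul_apply, Matrix.conjTranspose_apply, star_trivial, map_sum, map_mul,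
    Finset.sum_mul, sq, Finset.mul_sum]
  rw [Finset.sum_comm_cycle]
  refine Finset.sum_congr rfl fun i _ => Finset.sum_congr rfl fun j _ =>
    Finset.sum_congr rfl fun k _ => by ring

theorem natDegree_gramPoly_le {n d : ℕ} {L : Fin n → ℝ[X]} (hL : ∀ j, (L j).natDegree ≤ d)
    (G : Matrix (Fin n) (Fin n) ℝ) : (gramPoly L G).natDegree ≤ 2 * d :=
  natDegree_sum_le_of_forall_le _ _ fun j _ => natDegree_sum_le_of_forall_le _ _ fun k _ =>
    (natDegree_C_mul_le _ _).trans <| natDegree_mul_le.trans <| by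
      linarith [hL j, hL k]

open scoped MatrixOrder in
theorem isSosPoly_gramPoly {n : ℕ} (L : Fin n → ℝ[X]) {G : Matrix (Fin n) (Fin n) ℝ}
    (hG : G.PosSemidef) : IsSosPoly (gramPoly L G) := by
  obtain ⟨A, rfl⟩ := CStarAlgebra.nonneg_iff_eq_star_mul_self.mp hG.nonneg
  exact ⟨n, _, gramPoly_conjTranspose_mul_self L A⟩

/-- A sum of squares of degree at most `2 * d` has a positive semidefinite Gram matrix in the
Lagrange basis at `d + 1` nodes, whose entries are controlled by the values at the nodes. -/
theorem IsSosPoly.exists_gram {p : ℝ[X]} {d : ℕ} (hp : IsSosPoly p) (hd : p.natDegree ≤ 2 * d)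
    {v : Fin (d + 1) → ℝ} (hv : Function.Injective v) {M : ℝ} (hM : ∀ j, p.eval (v j) ≤ M) :
    ∃ G : Matrix (Fin (d + 1)) (Fin (d + 1)) ℝ, G.PosSemidef ∧ (∀ j k, |G j k| ≤ M) ∧
      p = gramPoly (Lagrange.basis Finset.univ v) G := by
  obtain ⟨r, g, rfl⟩ := hp
  let A : Matrix (Fin r) (Fin (d + 1)) ℝ := Matrix.of fun i j => (g i).eval (v j)
  refine ⟨A.conjTranspose * A, Matrix.posSemidef_conjTranspose_mul_self A, fun j k => ?_, ?_⟩
  · have hj := hM j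
    have hk := hM k
    simp only [eval_finsetSum, eval_pow] at hj hk
    simp only [Matrix.mul_apply, Matrix.conjTranspose_apply, star_trivial, A, Matrix.of_apply]
    calc |∑ i, (g i).eval (v j) * (g i).eval (v k)|
        ≤ ∑ i, |(g i).eval (v j) * (g i).eval (v k)| := Finset.abs_sum_le_sum_abs _ _
      _ ≤ ∑ i, ((g i).eval (v j) ^ 2 + (g i).eval (v k) ^ 2) / 2 :=
          Finset.sum_le_sum fun i _ => abs_le.2
            ⟨by linarith [sq_nonneg ((g i).eval (v j) + (g i).eval (v k))],
              by linarith [sq_nonneg ((g i).eval (v j) - (g i).eval (v k))]⟩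
      _ ≤ M := by rw [← Finset.sum_div, Finset.sum_add_distrib]; linarith
  · rw [gramPoly_conjTranspose_mul_self]
    refine Finset.sum_congr rfl fun i _ => congrArg (· ^ 2) ?_
    rw [Lagrange.eq_interpolate (f := g i) (s := Finset.univ) hv.injOn, Lagrange.interpolate_apply]
    · simp [A]
    · refine degree_le_natDegree.trans_lt ?_
      rw [Finset.card_univ, Fintype.card_fin, Nat.cast_lt]
      exact Nat.lt_succ_of_le (natDegree_le_of_natDegree_sum_sq_le hd i)

theorem isClosed_setOf_posSemidef (n : ℕ) :
    IsClosed {G : Fin n → Fin n → ℝ | Matrix.PosSemidef (Matrix.of G)} := by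
  simp only [Matrix.posSemidef_iff_dotProduct_mulVec, Matrix.IsHermitian.ext_iff, dotProduct,
    Matrix.mulVec, Set.ofPred_and, Set.ofPred_forall, Matrix.of_apply, star_trivial]
  refine .inter ?_ ?_
  · exact isClosed_iInter fun i => isClosed_iInter fun j =>
      isClosed_eq (by fun_prop) (by fun_prop)
  · exact isClosed_iInter fun x => isClosed_le (by fun_prop) (by fun_prop)

theorem continuous_eval_gramPoly {n : ℕ} (L : Fin n → ℝ[X]) (x : ℝ) :
    Continuous fun G : Fin n → Fin n → ℝ => (gramPoly L (Matrix.of G)).eval x := by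
  simp only [gramPoly, eval_finsetSum, eval_mul, eval_C, Matrix.of_apply]
  fun_prop

theorem one_eq_eval_of_certificate {a b : ℝ} {s t : ℝ[X]}
    (h : (1 : ℝ[X]) = (X ^ 2 + C a * X + C b) * t - (X ^ 2 - 1) * s) (x : ℝ) :
    1 = (x ^ 2 + a * x + b) * t.eval x - (x ^ 2 - 1) * s.eval x := by
  simpa using congrArg (eval x) h

theorem quadratic_pos_of_certificate {a b : ℝ} {s t : ℝ[X]} (ht : IsSosPoly t)
    (h : (1 : ℝ[X]) = (X ^ 2 + C a * X + C b) * t - (X ^ 2 - 1) * s) {x : ℝ} (hx : x ^ 2 = 1) :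
    0 < x ^ 2 + a * x + b := by
  have h1 := one_eq_eval_of_certificate h x
  rw [hx, sub_self, zero_mul, sub_zero] at h1
  rw [hx]
  exact pos_of_mul_pos_left (h1 ▸ one_pos) (ht.eval_nonneg x)

theorem notMem_Pbdry_of_certificate {a b : ℝ} {s t : ℝ[X]} (hs : IsSosPoly s) (ht : IsSosPoly t)
    (h : (1 : ℝ[X]) = (X ^ 2 + C a * X + C b) * t - (X ^ 2 - 1) * s) : (a, b) ∉ Pbdry := by
  rintro (⟨h1, h2⟩ | ⟨h1, -⟩)
  · have hx := one_eq_eval_of_certificate h (-a / 2)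
    have hs0 := hs.eval_nonneg (-a / 2)
    dsimp only at h1 h2
    have hroot : (-a / 2) ^ 2 + a * (-a / 2) + b = 0 := by linarith
    rw [hroot] at hx
    nlinarith
  · have hpos := quadratic_pos_of_certificate ht h (x := 1) (by norm_num)
    have hneg := quadratic_pos_of_certificate ht h (x := -1) (by norm_num)
    dsimp only at h1
    rcases abs_cases a with ⟨h2, -⟩ | ⟨h2, -⟩ <;> linarith

/-- A monic quadratic that is nonnegative at `±1` and differs from `X ^ 2 - 1` is positive
somewhere in `(-1, 1)`. -/
theorem exists_quadratic_pos {a b : ℝ} (hne : (a, b) ≠ (0, -1)) (h1 : 0 ≤ 1 + a + b)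
    (h2 : 0 ≤ 1 - a + b) : ∃ x : ℝ, x ^ 2 < 1 ∧ 0 < x ^ 2 + a * x + b := by
  by_contra! h
  have hcont : Continuous fun x : ℝ => x ^ 2 + a * x + b := by fun_prop
  have hle : ∀ x ∈ closure (Set.Ioo (-1 : ℝ) 1), x ^ 2 + a * x + b ≤ 0 :=
    closure_minimal (fun x hx => h x (by nlinarith [hx.1, hx.2]))
      (isClosed_le hcont continuous_const)
  rw [closure_Ioo (by norm_num)] at hle
  have h3 := hle 1 (by norm_num)
  have h4 := hle (-1) (by norm_num)
  exact hne (Prod.ext (by dsimp only; linarith) (by dsimp only; linarith))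

/-- Around a point of `(-1, 1)` where the quadratic is positive there are arbitrarily many such
points. -/
theorem exists_nodes {a b x : ℝ} (hx : x ^ 2 < 1) (hpos : 0 < x ^ 2 + a * x + b) (n : ℕ) :
    ∃ v : Fin n → ℝ, Function.Injective v ∧
      ∀ j, v j ^ 2 < 1 ∧ 0 < v j ^ 2 + a * v j + b := by
  have hopen : IsOpen {y : ℝ | y ^ 2 < 1 ∧ 0 < y ^ 2 + a * y + b} :=
    .and (isOpen_lt (by fun_prop) (by fun_prop)) (isOpen_lt (by fun_prop) (by fun_prop))
  have hinf := infinite_of_mem_nhds x (hopen.mem_nhds ⟨hx, hpos⟩)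
  let e := hinf.natEmbedding
  exact ⟨fun j => e j, fun i j hij => Fin.ext (e.injective (Subtype.ext hij)),
    fun j => (e j).2⟩

/-- Lemma 4.5: limits of bounded-degree sums-of-squares
certificates are again certificates, provided the limit point is not `(0,−1)`;
in particular the limit point cannot lie on `P'`. -/
theorem certificates_pass_to_limits
    (d : ℕ) (ab : ℕ → ℝ × ℝ) (a b : ℝ)
    (hconv : Filter.Tendsto ab Filter.atTop (nhds (a, b)))
    (hne : (a, b) ≠ (0, -1))
    (hcert : ∀ ν : ℕ, 1 ≤ ν → ∃ s t : Polynomial ℝ, IsSosPoly s ∧ IsSosPoly t ∧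
      s.natDegree ≤ 2 * d ∧ t.natDegree ≤ 2 * d ∧
      (1 : Polynomial ℝ) =
        (X ^ 2 + C (ab ν).1 * X + C (ab ν).2) * t - (X ^ 2 - 1) * s) :
    (∃ s t : Polynomial ℝ, IsSosPoly s ∧ IsSosPoly t ∧
      s.natDegree ≤ 2 * d ∧ t.natDegree ≤ 2 * d ∧
      (1 : Polynomial ℝ) = (X ^ 2 + C a * X + C b) * t - (X ^ 2 - 1) * s) ∧
    (a, b) ∉ Pbdry := by
  suffices hlim : ∃ s t : Polynomial ℝ, IsSosPoly s ∧ IsSosPoly t ∧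
      s.natDegree ≤ 2 * d ∧ t.natDegree ≤ 2 * d ∧
      (1 : Polynomial ℝ) = (X ^ 2 + C a * X + C b) * t - (X ^ 2 - 1) * s by
    refine ⟨hlim, ?_⟩
    obtain ⟨s, t, hs, ht, -, -, h⟩ := hlim
    exact notMem_Pbdry_of_certificate hs ht h
  have hquad : ∀ x : ℝ, Filter.Tendsto (fun ν => x ^ 2 + (ab ν).1 * x + (ab ν).2) Filter.atTop
      (nhds (x ^ 2 + a * x + b)) := fun x =>
    ((by fun_prop : Continuous fun p : ℝ × ℝ => x ^ 2 + p.1 * x + p.2).tendsto (a, b)).comp hconv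
  have hend : ∀ x : ℝ, x ^ 2 = 1 → 0 ≤ x ^ 2 + a * x + b := fun x hx => by
    refine ge_of_tendsto (hquad x) ?_
    filter_upwards [Filter.eventually_ge_atTop 1] with ν hν
    obtain ⟨s, t, -, ht, -, -, h⟩ := hcert ν hν
    exact (quadratic_pos_of_certificate ht h hx).le
  obtain ⟨x, hx, hpos⟩ := exists_quadratic_pos hne (by linarith [hend 1 (by norm_num)])
    (by linarith [hend (-1) (by norm_num)])
  obtain ⟨v, hv, hnode⟩ := exists_nodes hx hpos (d + 1)
  choose δ hδ hδs hδt using fun j => show ∃ δ > 0, δ ≤ 1 - v j ^ 2 ∧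
      δ < v j ^ 2 + a * v j + b from by
    obtain ⟨δ, h1, h2⟩ := exists_between (lt_min (sub_pos.2 (hnode j).1) (hnode j).2)
    exact ⟨δ, h1, (h2.trans_le (min_le_left _ _)).le, h2.trans_le (min_le_right _ _)⟩
  obtain ⟨M, hM⟩ := (Set.finite_range fun j => (δ j)⁻¹).bddAbove
  have hbound : ∀ j (y z p q : ℝ), 1 = y * p - z * q → δ j ≤ y → δ j ≤ -z → 0 ≤ p → 0 ≤ q →
      q ≤ M ∧ p ≤ M := fun j y z p q h hy hz hp hq => by
    have hMj : (δ j)⁻¹ ≤ M := hM ⟨j, rfl⟩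
    have hyp := mul_le_mul_of_nonneg_right hy hp
    have hzq := mul_le_mul_of_nonneg_right hz hq
    have hp' := mul_nonneg (hδ j).le hp
    have hq' := mul_nonneg (hδ j).le hq
    constructor <;> refine le_trans ?_ hMj <;> rw [inv_eq_one_div, le_div_iff₀ (hδ j)] <;> linarith
  let L : Fin (d + 1) → ℝ[X] := Lagrange.basis Finset.univ v
  have hL : ∀ j, (L j).natDegree ≤ d := fun j => by
    rw [Lagrange.natDegree_basis hv.injOn (Finset.mem_univ j)]; simp
  let K : Set (Fin (d + 1) → Fin (d + 1) → ℝ) :=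
    Set.Icc (fun _ _ => -M) (fun _ _ => M) ∩ {G | Matrix.PosSemidef (Matrix.of G)}
  have hK : IsCompact K := isCompact_Icc.inter_right (isClosed_setOf_posSemidef (d + 1))
  have hgram : ∀ᶠ ν in Filter.atTop, ∃ GH ∈ K ×ˢ K,
      (1 : ℝ[X]) = (X ^ 2 + C (ab ν).1 * X + C (ab ν).2) * gramPoly L (Matrix.of GH.2) -
        (X ^ 2 - 1) * gramPoly L (Matrix.of GH.1) := by
    filter_upwards [Filter.eventually_ge_atTop 1,
      Filter.eventually_all.2 fun j => (hquad (v j)).eventually_const_lt (hδt j)] with ν hν hlt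
    obtain ⟨s, t, hs, ht, hsd, htd, h⟩ := hcert ν hν
    have hst := fun j => hbound j _ _ _ _ (one_eq_eval_of_certificate h (v j)) (hlt j).le
      (by linarith [hδs j]) (ht.eval_nonneg _) (hs.eval_nonneg _)
    obtain ⟨G, hG, hGM, rfl⟩ := hs.exists_gram hsd hv fun j => (hst j).1
    obtain ⟨H, hH, hHM, rfl⟩ := ht.exists_gram htd hv fun j => (hst j).2
    exact ⟨(G, H), ⟨⟨⟨fun j k => (abs_le.1 (hGM j k)).1, fun j k => (abs_le.1 (hGM j k)).2⟩, hG⟩,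
      ⟨fun j k => (abs_le.1 (hHM j k)).1, fun j k => (abs_le.1 (hHM j k)).2⟩, hH⟩, h⟩
  obtain ⟨N, hN⟩ := Filter.eventually_atTop.1 hgram
  choose GH hmem heq using fun n => hN (n + N) (Nat.le_add_left N n)
  obtain ⟨⟨G, H⟩, ⟨hG, hH⟩, φ, hφ, hlim⟩ := (hK.prod hK).tendsto_subseq hmem
  refine ⟨gramPoly L (Matrix.of G), gramPoly L (Matrix.of H), isSosPoly_gramPoly L hG.2,
    isSosPoly_gramPoly L hH.2, natDegree_gramPoly_le hL _, natDegree_gramPoly_le hL _,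
    Polynomial.funext fun y => ?_⟩
  have hshift : Filter.Tendsto (fun n => φ n + N) Filter.atTop Filter.atTop :=
    (Filter.tendsto_add_atTop_nat N).comp hφ.tendsto_atTop
  have hGy := ((continuous_eval_gramPoly L y).tendsto G).comp
    ((continuous_fst.tendsto (G, H)).comp hlim)
  have hHy := ((continuous_eval_gramPoly L y).tendsto H).comp
    ((continuous_snd.tendsto (G, H)).comp hlim)
  have hy := (((hquad y).comp hshift).mul hHy).sub (hGy.const_mul (y ^ 2 - 1))
  have hone := tendsto_nhds_unique (tendsto_const_nhds.congr fun n =>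
    one_eq_eval_of_certificate (heq (φ n)) y) hy
  simpa using hone

end
end

section
/- For each integer N ≥ 0, the set {(a,b) ∈ P : N(a,b) ≤ N} is relatively closed in P (i.e., closed in the subspace topology of P ⊆ ℝ²). -/
open Polynomial

noncomputable section

/-- The defining polynomial `y² + q(x)` of the curve, as a polynomial in `y`
over `ℝ[x]`. -/
def curvePoly (q : Polynomial ℝ) : Polynomial (Polynomial ℝ) :=
  X ^ 2 + C q

lemma curvePoly_monic (q : Polynomial ℝ) : (curvePoly q).Monic :=
  Polynomial.monic_X_pow_add_C q (by norm_num)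

/-- The coordinate ring `ℝ[C] = ℝ[x,y]/(y² + q(x))`. -/
abbrev CurveRing (q : Polynomial ℝ) : Type := AdjoinRoot (curvePoly q)

/-- The unique representative `a(x) + b(x)·y` (of `y`-degree `< 2`) of an element. -/
def curveRep (q : Polynomial ℝ) (f : CurveRing q) : Polynomial (Polynomial ℝ) :=
  AdjoinRoot.modByMonicHom (curvePoly_monic q) f

/-- The polynomial `a(x)` with `f = a(x) + b(x)·y`. -/
def repA (q : Polynomial ℝ) (f : CurveRing q) : Polynomial ℝ := (curveRep q f).coeff 0

/-- The polynomial `b(x)` with `f = a(x) + b(x)·y`. -/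
def repB (q : Polynomial ℝ) (f : CurveRing q) : Polynomial ℝ := (curveRep q f).coeff 1

/-- `δ(f) = max (deg a, 2 + deg b)` for `f = a(x) + b(x)·y ≠ 0`. -/
def curveDelta (q : Polynomial ℝ) (f : CurveRing q) : ℕ :=
  if repB q f = 0 then (repA q f).natDegree
  else max (repA q f).natDegree (2 + (repB q f).natDegree)

/-- `f ∈ ℝ[C]` is psd: nonnegative at all real points of the curve. -/
def IsPsd (q : Polynomial ℝ) (f : CurveRing q) : Prop :=
  ∀ u v : ℝ, v ^ 2 + q.eval u = 0 → 0 ≤ (repA q f).eval u + (repB q f).eval u * v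

/-- `f` is a sum of squares of elements of `δ`-degree at most `d`. -/
def IsSosLe (q : Polynomial ℝ) (f : CurveRing q) (d : ℕ) : Prop :=
  ∃ (r : ℕ) (g : Fin r → CurveRing q), f = ∑ i, g i ^ 2 ∧ ∀ i, curveDelta q (g i) ≤ d

/-- `θ(f)`: the least `d` such that `f` is a sum of squares of elements of
`δ`-degree `≤ d`, and `∞` if `f` is not a sum of squares. -/
def curveTheta (q : Polynomial ℝ) (f : CurveRing q) : ℕ∞ :=
  sInf {d : ℕ∞ | ∃ n : ℕ, d = (n : ℕ∞) ∧ IsSosLe q f n}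

/-- All zeros of `f` on `C(ℂ)` are real. -/
def AllZerosReal (q : Polynomial ℝ) (f : CurveRing q) : Prop :=
  ∀ u v : ℂ, v ^ 2 + (q.map (algebraMap ℝ ℂ)).eval u = 0 →
    ((repA q f).map (algebraMap ℝ ℂ)).eval u +
      ((repB q f).map (algebraMap ℝ ℂ)).eval u * v = 0 →
    u.im = 0 ∧ v.im = 0

/-- The parameter set `P`. -/
def Pset : Set (ℝ × ℝ) :=
  {p | p.1 ^ 2 - 4 * p.2 < 0 ∨ (0 < p.1 ^ 2 - 4 * p.2 ∧ |p.1| < min 2 (p.2 + 1))}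

/-- The quartic `q_{a,b}(x) = (x² − 1)(x² + ax + b)`. -/
def qab (a b : ℝ) : Polynomial ℝ := (X ^ 2 - 1) * (X ^ 2 + C a * X + C b)

/-- The stability constant `N(a,b) = θ(1 − x²)`, computed in `ℝ[C_{a,b}]`. -/
def Nab (a b : ℝ) : ℕ∞ :=
  curveTheta (qab a b) (AdjoinRoot.of (curvePoly (qab a b)) (1 - X ^ 2))

/-- The element `a(x) + b(x)·y` of the coordinate ring. -/
def curveElt (q a b : ℝ[X]) : CurveRing q :=
  AdjoinRoot.mk (curvePoly q) (C a + C b * X)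

lemma curveRep_curveElt (q a b : ℝ[X]) : curveRep q (curveElt q a b) = C a + C b * X := by
  rw [curveRep, curveElt, AdjoinRoot.modByMonicHom_mk,
    Polynomial.modByMonic_eq_self_iff (curvePoly_monic q), curvePoly,
    degree_X_pow_add_C (by norm_num), add_comm]
  exact degree_linear_le.trans_lt (by norm_num)

lemma repA_curveElt (q a b : ℝ[X]) : repA q (curveElt q a b) = a := by
  simp [repA, curveRep_curveElt]

lemma repB_curveElt (q a b : ℝ[X]) : repB q (curveElt q a b) = b := by
  simp [repB, curveRep_curveElt]

lemma curveElt_inj {q a b a' b' : ℝ[X]} :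
    curveElt q a b = curveElt q a' b' ↔ a = a' ∧ b = b' := by
  refine ⟨fun h => ⟨?_, ?_⟩, fun h => by rw [h.1, h.2]⟩
  · simpa [repA_curveElt] using congrArg (repA q) h
  · simpa [repB_curveElt] using congrArg (repB q) h

lemma curveElt_rep (q : ℝ[X]) (f : CurveRing q) : curveElt q (repA q f) (repB q f) = f := by
  obtain ⟨p, rfl⟩ := AdjoinRoot.mk_surjective f
  have hlt : (p %ₘ curvePoly q).degree < 2 := by
    refine (degree_modByMonic_lt p (curvePoly_monic q)).trans_eq ?_
    rw [curvePoly, degree_X_pow_add_C (by norm_num)]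
    rfl
  have hle : (p %ₘ curvePoly q).degree ≤ 1 := Order.le_of_lt_succ hlt
  have hrep : curveRep q (AdjoinRoot.mk _ p) = p %ₘ curvePoly q :=
    AdjoinRoot.modByMonicHom_mk _ _
  rw [curveElt, repA, repB, hrep, add_comm, ← eq_X_add_C_of_degree_le_one hle, ← hrep]
  exact AdjoinRoot.mk_leftInverse (curvePoly_monic q) _

lemma curveElt_sq (q a b : ℝ[X]) :
    curveElt q a b ^ 2 = curveElt q (a ^ 2 - q * b ^ 2) (2 * (a * b)) := by
  have h : AdjoinRoot.mk (curvePoly q) (C b ^ 2 * curvePoly q) = 0 := by simp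
  rw [curveElt, curveElt, ← map_pow, ← sub_eq_zero, ← map_sub, ← h]
  congr 1
  simp only [curvePoly, map_sub, map_mul, map_pow, map_ofNat]
  ring

lemma sum_curveElt {ι : Type*} (s : Finset ι) (q : ℝ[X]) (a b : ι → ℝ[X]) :
    ∑ i ∈ s, curveElt q (a i) (b i) = curveElt q (∑ i ∈ s, a i) (∑ i ∈ s, b i) := by
  simp only [curveElt, ← map_sum, Finset.sum_add_distrib, ← Finset.sum_mul]

lemma of_eq_curveElt (q f : ℝ[X]) : AdjoinRoot.of (curvePoly q) f = curveElt q f 0 := by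
  simp [curveElt]

lemma of_eq_sum_sq_curveElt_iff {ι : Type*} (s : Finset ι) (q f : ℝ[X]) (a b : ι → ℝ[X]) :
    AdjoinRoot.of (curvePoly q) f = ∑ i ∈ s, curveElt q (a i) (b i) ^ 2 ↔
      f = ∑ i ∈ s, a i ^ 2 - q * ∑ i ∈ s, b i ^ 2 ∧ ∑ i ∈ s, a i * b i = 0 := by
  simp only [curveElt_sq, sum_curveElt, of_eq_curveElt, curveElt_inj, Finset.sum_sub_distrib,
    ← Finset.mul_sum]
  refine and_congr_right fun _ => ?_
  rw [eq_comm, mul_eq_zero]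
  simp

lemma curveDelta_curveElt_le_iff (q a b : ℝ[X]) (n : ℕ) :
    curveDelta q (curveElt q a b) ≤ n ↔ a.degree < (n + 1 : ℕ) ∧ b.degree < (n - 1 : ℕ) := by
  have ha : a.degree < (n + 1 : ℕ) ↔ a.natDegree ≤ n := by
    rw [natDegree_le_iff_degree_le]
    exact Order.lt_succ_iff (b := (n : WithBot ℕ))
  rw [curveDelta, repA_curveElt, repB_curveElt, ha]
  split_ifs with hb
  · simp [hb, bot_lt_iff_ne_bot]
  · rw [degree_eq_natDegree hb, Nat.cast_lt, max_le_iff]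
    refine and_congr_right fun _ => ?_
    omega

lemma IsSosLe.mono {q : ℝ[X]} {f : CurveRing q} {m n : ℕ} (h : IsSosLe q f m) (hmn : m ≤ n) :
    IsSosLe q f n := by
  obtain ⟨r, g, hf, hg⟩ := h
  exact ⟨r, g, hf, fun i => (hg i).trans hmn⟩

lemma curveTheta_le_iff (q : ℝ[X]) (f : CurveRing q) (n : ℕ) :
    curveTheta q f ≤ n ↔ IsSosLe q f n := by
  refine ⟨fun h => ?_, fun h => sInf_le ⟨n, rfl, h⟩⟩
  rcases Set.eq_empty_or_nonempty {d : ℕ∞ | ∃ n : ℕ, d = (n : ℕ∞) ∧ IsSosLe q f n} with he | hne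
  · rw [curveTheta, he, sInf_empty] at h
    exact absurd h (by simp)
  · obtain ⟨m, hm, hsos⟩ := csInf_mem hne
    refine hsos.mono ?_
    rw [curveTheta, hm] at h
    exact_mod_cast h

/-- The values at `x` of the Lagrange basis of the nodes `u 0, …, u (n - 1)`. -/
def lagrangeVec (u : ℕ → ℝ) (n : ℕ) (x : ℝ) (k : Fin n) : ℝ :=
  (Lagrange.basis Finset.univ (fun j : Fin n => u j) k).eval x

lemma eval_interpolate_eq_sum (u : ℕ → ℝ) (n : ℕ) (w : Fin n → ℝ) (x : ℝ) :
    (Lagrange.interpolate Finset.univ (fun j : Fin n => u j) w).eval x =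
      ∑ k, w k * lagrangeVec u n x k := by
  simp [Lagrange.interpolate_apply, eval_finsetSum, lagrangeVec]

lemma eval_eq_sum_lagrangeVec {u : ℕ → ℝ} (hu : u.Injective) {n : ℕ} {a : ℝ[X]}
    (ha : a.degree < n) (x : ℝ) :
    a.eval x = ∑ k : Fin n, a.eval (u k) * lagrangeVec u n x k := by
  rw [← eval_interpolate_eq_sum, ← Lagrange.eq_interpolate]
  · exact (hu.comp Fin.val_injective).injOn
  · simpa using ha

lemma lagrangeVec_node {u : ℕ → ℝ} (hu : u.Injective) {n : ℕ} (k : Fin n) :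
    lagrangeVec u n (u k) = Pi.single k 1 := by
  ext j
  by_cases h : j = k
  · subst h
    simpa [lagrangeVec] using Lagrange.eval_basis_self (v := fun j : Fin n => u j)
      (hu.comp Fin.val_injective).injOn (Finset.mem_univ j)
  · simpa [lagrangeVec, h] using
      Lagrange.eval_basis_of_ne (v := fun j : Fin n => u j) h (Finset.mem_univ k)

/-- The evaluation vector at `x` of the `a`-part of `a(x) + b(x)·y`, in Lagrange coordinates. -/
def evalVecA (u : ℕ → ℝ) (n : ℕ) (x : ℝ) : Fin (n + 1) ⊕ Fin (n - 1) → ℝ :=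
  Sum.elim (lagrangeVec u (n + 1) x) 0

/-- The evaluation vector at `x` of the `b`-part of `a(x) + b(x)·y`, in Lagrange coordinates. -/
def evalVecB (u : ℕ → ℝ) (n : ℕ) (x : ℝ) : Fin (n + 1) ⊕ Fin (n - 1) → ℝ :=
  Sum.elim 0 (lagrangeVec u (n - 1) x)

lemma evalVecA_node {u : ℕ → ℝ} (hu : u.Injective) {n : ℕ} (k : Fin (n + 1)) :
    evalVecA u n (u k) = Pi.single (Sum.inl k) 1 := by
  rw [evalVecA, lagrangeVec_node hu, Sum.elim_single_zero]

lemma evalVecB_node {u : ℕ → ℝ} (hu : u.Injective) {n : ℕ} (k : Fin (n - 1)) :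
    evalVecB u n (u k) = Pi.single (Sum.inr k) 1 := by
  rw [evalVecB, lagrangeVec_node hu, Sum.elim_zero_single]

open Matrix in
/-- The rows of `M` are the Lagrange coordinates of elements whose squares sum up to `f`. -/
def IsGramRoot (u : ℕ → ℝ) (n : ℕ) (q f : ℝ[X]) {ι : Type*} [Fintype ι]
    (M : Matrix ι (Fin (n + 1) ⊕ Fin (n - 1)) ℝ) : Prop :=
  ∀ x, f.eval x = (M *ᵥ evalVecA u n x) ⬝ᵥ (M *ᵥ evalVecA u n x) -
      q.eval x * ((M *ᵥ evalVecB u n x) ⬝ᵥ (M *ᵥ evalVecB u n x)) ∧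
    (M *ᵥ evalVecA u n x) ⬝ᵥ (M *ᵥ evalVecB u n x) = 0

open Matrix in
lemma Matrix.mulVec_dotProduct_mulVec_self {ι κ : Type*} [Fintype ι] [Fintype κ]
    (M : Matrix ι κ ℝ) (v w : κ → ℝ) : (M *ᵥ v) ⬝ᵥ (M *ᵥ w) = v ⬝ᵥ ((Mᵀ * M) *ᵥ w) := by
  rw [← Matrix.mulVec_mulVec, Matrix.dotProduct_mulVec v, Matrix.vecMul_transpose]

open scoped Matrix MatrixOrder in
lemma Matrix.exists_square_transpose_mul_self {ι κ : Type*} [Fintype ι] [Fintype κ]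
    [DecidableEq κ] (M : Matrix ι κ ℝ) : ∃ B : Matrix κ κ ℝ, Bᵀ * B = Mᵀ * M := by
  have h : (Mᵀ * M).PosSemidef := by
    simpa using Matrix.posSemidef_conjTranspose_mul_self M
  obtain ⟨B, hB⟩ := CStarAlgebra.nonneg_iff_eq_star_mul_self.mp h.nonneg
  exact ⟨B, by simpa [star_eq_conjTranspose] using hB.symm⟩

lemma isSosLe_iff_exists_isGramRoot {u : ℕ → ℝ} (hu : u.Injective) (n : ℕ) (q f : ℝ[X]) :
    IsSosLe q (AdjoinRoot.of (curvePoly q) f) n ↔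
      ∃ B : Matrix (Fin (n + 1) ⊕ Fin (n - 1)) (Fin (n + 1) ⊕ Fin (n - 1)) ℝ,
        IsGramRoot u n q f B := by
  constructor
  · rintro ⟨r, g, hf, hg⟩
    set a : Fin r → ℝ[X] := fun i => repA q (g i)
    set b : Fin r → ℝ[X] := fun i => repB q (g i)
    have hgi (i) : g i = curveElt q (a i) (b i) := (curveElt_rep q (g i)).symm
    simp only [hgi] at hf hg
    simp only [curveDelta_curveElt_le_iff] at hg
    rw [of_eq_sum_sq_curveElt_iff] at hf
    let M : Matrix (Fin r) (Fin (n + 1) ⊕ Fin (n - 1)) ℝ := Matrix.of fun i =>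
      Sum.elim (fun k => (a i).eval (u k)) (fun k => (b i).eval (u k))
    have hA (x) : M.mulVec (evalVecA u n x) = fun i => (a i).eval x := by
      ext i
      rw [eval_eq_sum_lagrangeVec hu (hg i).1]
      simp [M, Matrix.mulVec, dotProduct, evalVecA]
    have hB (x) : M.mulVec (evalVecB u n x) = fun i => (b i).eval x := by
      ext i
      rw [eval_eq_sum_lagrangeVec hu (hg i).2]
      simp [M, Matrix.mulVec, dotProduct, evalVecB]
    have hM : IsGramRoot u n q f M := by
      intro x
      rw [hA, hB]
      refine ⟨?_, ?_⟩
      · simpa [eval_finsetSum, dotProduct, ← sq] using congrArg (eval x) hf.1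
      · simpa [eval_finsetSum, dotProduct] using congrArg (eval x) hf.2
    obtain ⟨B, hB⟩ := M.exists_square_transpose_mul_self
    refine ⟨B, fun x => ?_⟩
    simpa only [Matrix.mulVec_dotProduct_mulVec_self, hB] using hM x
  · rintro ⟨B, hB⟩
    let a (i) := Lagrange.interpolate Finset.univ (fun j : Fin (n + 1) => u j)
      fun k => B i (Sum.inl k)
    let b (i) := Lagrange.interpolate Finset.univ (fun j : Fin (n - 1) => u j)
      fun k => B i (Sum.inr k)
    have hA (x) (i) : (a i).eval x = B.mulVec (evalVecA u n x) i := by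
      simp [a, eval_interpolate_eq_sum, Matrix.mulVec, dotProduct, evalVecA,
        -Lagrange.interpolate_apply]
    have hB' (x) (i) : (b i).eval x = B.mulVec (evalVecB u n x) i := by
      simp [b, eval_interpolate_eq_sum, Matrix.mulVec, dotProduct, evalVecB,
        -Lagrange.interpolate_apply]
    have hsum : AdjoinRoot.of (curvePoly q) f = ∑ i, curveElt q (a i) (b i) ^ 2 := by
      rw [of_eq_sum_sq_curveElt_iff]
      refine ⟨Polynomial.funext fun x => ?_, Polynomial.funext fun x => ?_⟩
      · simpa [eval_finsetSum, hA, hB', sq, dotProduct] using (hB x).1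
      · simpa [eval_finsetSum, hA, hB', dotProduct] using (hB x).2
    let e := Fintype.equivFin (Fin (n + 1) ⊕ Fin (n - 1))
    refine ⟨_, fun i => curveElt q (a (e.symm i)) (b (e.symm i)), ?_, fun i => ?_⟩
    · rw [hsum, ← e.symm.sum_comp]
    · rw [curveDelta_curveElt_le_iff]
      constructor
      · simpa [a, b] using Lagrange.degree_interpolate_lt
          (s := Finset.univ) (v := fun j : Fin (n + 1) => u j)
          (fun k => B (e.symm i) (Sum.inl k)) (hu.comp Fin.val_injective).injOn
      · simpa [a, b] using Lagrange.degree_interpolate_lt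
          (s := Finset.univ) (v := fun j : Fin (n - 1) => u j)
          (fun k => B (e.symm i) (Sum.inr k)) (hu.comp Fin.val_injective).injOn

lemma sq_le_dotProduct_self {ι : Type*} [Fintype ι] (v : ι → ℝ) (i : ι) :
    v i ^ 2 ≤ v ⬝ᵥ v := by
  rw [sq]
  exact Finset.single_le_sum (f := fun j => v j * v j) (fun j _ => mul_self_nonneg _)
    (Finset.mem_univ i)

/-- If the curve has real points over every node, and `-q` is bounded below there, the entries
of a Gram root are bounded. -/
lemma IsGramRoot.abs_le {u : ℕ → ℝ} (hu : u.Injective) {n : ℕ} {q f : ℝ[X]} {ι : Type*}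
    [Fintype ι] {M : Matrix ι (Fin (n + 1) ⊕ Fin (n - 1)) ℝ} (hM : IsGramRoot u n q f M)
    {c : ℝ} (hc : 0 < c) (hc1 : c ≤ 1) (hq : ∀ k < n + 1, c ≤ -q.eval (u k))
    (hf : ∀ k, f.eval (u k) ≤ 1) (i : ι) (j : Fin (n + 1) ⊕ Fin (n - 1)) :
    |M i j| ≤ c⁻¹ := by
  have hnn {v : ι → ℝ} : 0 ≤ v ⬝ᵥ v := Finset.sum_nonneg fun _ _ => mul_self_nonneg _
  have h1 : 1 ≤ c⁻¹ := (one_le_inv₀ hc).2 hc1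
  have key : M i j ^ 2 ≤ c⁻¹ := by
    rcases j with k | k
    · have h := (hM (u k)).1
      rw [evalVecA_node hu k] at h
      have hle := sq_le_dotProduct_self (M.mulVec (Pi.single (Sum.inl k) 1)) i
      have := mul_nonneg (hc.le.trans (hq k k.2)) (hnn (v := M.mulVec (evalVecB u n (u k))))
      have := hf k
      simp only [Matrix.mulVec_single_one, Matrix.col_apply] at hle h
      linarith
    · have h := (hM (u k)).1
      rw [evalVecB_node hu k] at h
      have hle := sq_le_dotProduct_self (M.mulVec (Pi.single (Sum.inr k) 1)) i
      have := mul_le_mul_of_nonneg_right (hq k (by omega))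
        (hnn (v := M.mulVec (Pi.single (Sum.inr k) 1)))
      have := hnn (v := M.mulVec (evalVecA u n (u k)))
      have := hf k
      simp only [Matrix.mulVec_single_one, Matrix.col_apply] at *
      rw [← one_div, le_div_iff₀ hc]
      nlinarith
  exact abs_le_of_sq_le_sq (key.trans (by nlinarith)) (by positivity)

lemma eval_qab (a b x : ℝ) : (qab a b).eval x = (x ^ 2 - 1) * (x ^ 2 + a * x + b) := by
  simp [qab]

lemma one_add_add_pos {a b : ℝ} (h : (a, b) ∈ Pset) : 0 < 1 + a + b := by
  rcases h with h | ⟨-, h⟩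
  · simp only at h
    nlinarith [sq_nonneg (a + 2)]
  · simp only [lt_min_iff] at h
    linarith [neg_abs_le a]

open Filter Topology

lemma exists_injective_nodes {a b : ℝ} (h : (a, b) ∈ Pset) :
    ∃ u : ℕ → ℝ, u.Injective ∧ ∀ k, 0 < -(qab a b).eval (u k) := by
  have hpos : ∀ᶠ x in 𝓝[<] (1 : ℝ), 0 < x ^ 2 + a * x + b := by
    have hc : ContinuousAt (fun x : ℝ => x ^ 2 + a * x + b) 1 := by fun_prop
    refine (hc.eventually_const_lt ?_).filter_mono nhdsWithin_le_nhds
    simpa using one_add_add_pos h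
  have hset : ∀ᶠ x in 𝓝[<] (1 : ℝ), 0 < -(qab a b).eval x := by
    filter_upwards [hpos, Ioo_mem_nhdsLT (show (-1 : ℝ) < 1 by norm_num)] with x hx hx1
    rw [eval_qab, ← neg_mul]
    exact mul_pos (by nlinarith [hx1.1, hx1.2]) hx
  obtain ⟨l, hl, hsub⟩ := mem_nhdsLT_iff_exists_Ioo_subset.mp hset
  have hinf := (Set.Ioo_infinite hl).mono hsub
  exact ⟨fun k => hinf.natEmbedding _ k,
    Subtype.val_injective.comp (hinf.natEmbedding _).injective,
    fun k => (hinf.natEmbedding _ k).2⟩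

lemma eventually_le_neg_eval_qab {p : ℝ × ℝ} {u : ℕ → ℝ}
    (hu : ∀ k, 0 < -(qab p.1 p.2).eval (u k)) (n : ℕ) :
    ∃ c : ℝ, 0 < c ∧ c ≤ 1 ∧ ∀ᶠ p' in 𝓝 p, ∀ k < n, c ≤ -(qab p'.1 p'.2).eval (u k) := by
  induction n with
  | zero => exact ⟨1, one_pos, le_rfl, by simp⟩
  | succ n ih =>
    obtain ⟨c, hc, hc1, hev⟩ := ih
    have hcont : ContinuousAt (fun p' : ℝ × ℝ => -(qab p'.1 p'.2).eval (u n)) p := by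
      simp only [eval_qab]
      fun_prop
    refine ⟨min c (-(qab p.1 p.2).eval (u n) / 2), lt_min hc (half_pos (hu n)),
      (min_le_left _ _).trans hc1, ?_⟩
    filter_upwards [hev, hcont.eventually_const_lt (half_lt_self (hu n))] with p' h1 h2 k hk
    rcases Nat.lt_succ_iff_lt_or_eq.mp hk with hk | rfl
    · exact (min_le_left _ _).trans (h1 k hk)
    · exact (min_le_right _ _).trans h2.le

lemma isClosed_setOf_isGramRoot (u : ℕ → ℝ) (n : ℕ) (f : ℝ[X]) (ι : Type*) [Fintype ι] :
    IsClosed {z : (ℝ × ℝ) × Matrix ι (Fin (n + 1) ⊕ Fin (n - 1)) ℝ |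
      IsGramRoot u n (qab z.1.1 z.1.2) f z.2} := by
  simp only [IsGramRoot, eval_qab, Set.ofPred_forall]
  refine isClosed_iInter fun x => IsClosed.inter ?_ ?_
  · exact isClosed_eq (by fun_prop) (by fun_prop)
  · exact isClosed_eq (by fun_prop) (by fun_prop)

lemma isCompact_setOf_abs_le (ι κ : Type*) (R : ℝ) :
    IsCompact {M : Matrix ι κ ℝ | ∀ i j, |M i j| ≤ R} := by
  have h : IsCompact (Set.pi Set.univ fun _ : ι => Set.pi Set.univ fun _ : κ => Set.Icc (-R) R) :=
    isCompact_univ_pi fun _ => isCompact_univ_pi fun _ => isCompact_Icc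
  convert! h using 1
  exact Set.ext fun (M : Matrix ι κ ℝ) =>
    ⟨fun hM i _ j _ => abs_le.1 (hM i j), fun hM i j => abs_le.2 (hM i trivial j trivial)⟩

/-- Corollary 4.6(a) / `boundexplode`(a): for each `N`, the set
`{(a,b) ∈ P : N(a,b) ≤ N}` is relatively closed in `P`. -/
theorem sublevel_sets_of_stability_constant_closed (N : ℕ) :
    IsClosed {p : ↥Pset | Nab p.1.1 p.1.2 ≤ (N : ℕ∞)} := by
  refine IsSeqClosed.isClosed fun p p₀ hp hlim => ?_
  obtain ⟨u, hu, hpos⟩ := exists_injective_nodes p₀.2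
  obtain ⟨c, hc, hc1, hev⟩ := eventually_le_neg_eval_qab hpos (N + 1)
  simp only [Set.mem_ofPred_eq, Nab, curveTheta_le_iff, isSosLe_iff_exists_isGramRoot hu] at hp ⊢
  choose B hB using hp
  have hlim' : Tendsto (fun m => (p m : ℝ × ℝ)) atTop (𝓝 p₀) :=
    (continuous_subtype_val.tendsto p₀).comp hlim
  have hbdd : ∀ᶠ m in atTop, B m ∈ {M | ∀ i j, |M i j| ≤ c⁻¹} := by
    filter_upwards [hlim'.eventually hev] with m hm
    exact (hB m).abs_le hu hc hc1 hm fun k => by simpa using sq_nonneg (u k)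
  have : FirstCountableTopology
      (Matrix (Fin (N + 1) ⊕ Fin (N - 1)) (Fin (N + 1) ⊕ Fin (N - 1)) ℝ) :=
    inferInstanceAs (FirstCountableTopology (_ → _ → ℝ))
  obtain ⟨B₀, -, φ, hφ, hB₀⟩ := (isCompact_setOf_abs_le _ _ c⁻¹).tendsto_subseq' hbdd.frequently
  exact ⟨B₀, (isClosed_setOf_isGramRoot u N _ _).mem_of_tendsto
    ((hlim'.comp hφ.tendsto_atTop).prodMk_nhds hB₀) (Eventually.of_forall fun m => hB (φ m))⟩

end
end

section
/- Let (a₀,b₀) ∈ P' with (a₀,b₀) ≠ (0,−1). Then N(a,b) tends to infinity as (a,b) ∈ P tends to (a₀,b₀): for every integer N there is ε > 0 such that every (a,b) ∈ P with |(a,b) − (a₀,b₀)| < ε satisfies N(a,b) > N. -/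
open Polynomial

noncomputable section

/-- The unique representative of an element of the curve ring is `a(x) + b(x)·y`. -/
lemma curveRep_eq (q : Polynomial ℝ) (f : CurveRing q) :
    curveRep q f = C (repB q f) * X + C (repA q f) := by
  have hdeg : (curvePoly q).degree = 2 := by
    unfold curvePoly
    exact degree_X_pow_add_C (by norm_num) q
  obtain ⟨p, rfl⟩ := AdjoinRoot.mk_surjective f
  refine eq_X_add_C_of_degree_le_one ?_
  have hlt : (curveRep q (AdjoinRoot.mk _ p)).degree < 2 := by
    rw [curveRep, AdjoinRoot.modByMonicHom_mk, ← hdeg]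
    exact degree_modByMonic_lt _ (curvePoly_monic q)
  exact Order.le_of_lt_succ hlt

lemma mk_curveRep (q : Polynomial ℝ) (f : CurveRing q) :
    AdjoinRoot.mk (curvePoly q) (curveRep q f) = f :=
  AdjoinRoot.mk_leftInverse (curvePoly_monic q) f

/-- Evaluation of a sum-of-squares identity at both points of the curve above `x`,
averaged. -/
lemma eval_eq_of_eq_sum_sq (q h : Polynomial ℝ) {r : ℕ} (g : Fin r → CurveRing q)
    (hg : AdjoinRoot.of (curvePoly q) h = ∑ i, g i ^ 2) (x : ℝ) :
    h.eval x = ∑ i, ((repA q (g i)).eval x ^ 2 - q.eval x * (repB q (g i)).eval x ^ 2) := by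
  obtain ⟨w, hw⟩ : ∃ w : ℂ, w ^ 2 = -((q.eval x : ℝ) : ℂ) :=
    IsAlgClosed.exists_pow_nat_eq _ (by norm_num)
  have key : ∀ z : ℂ, z ^ 2 = -((q.eval x : ℝ) : ℂ) → ((h.eval x : ℝ) : ℂ) =
      ∑ i, ((((repB q (g i)).eval x : ℝ) : ℂ) * z + (((repA q (g i)).eval x : ℝ) : ℂ)) ^ 2 := by
    intro z hz
    let φ : Polynomial ℝ →+* ℂ := Complex.ofRealHom.comp (evalRingHom x)
    have hφ : ∀ p, φ p = ((p.eval x : ℝ) : ℂ) := fun p => rfl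
    have hroot : (curvePoly q).eval₂ φ z = 0 := by
      simp [curvePoly, hφ, hz]
    have h1 := congrArg (AdjoinRoot.lift φ z hroot) hg
    rw [AdjoinRoot.lift_of, map_sum, hφ] at h1
    rw [h1]
    refine Finset.sum_congr rfl fun i _ => ?_
    rw [map_pow]
    conv_lhs => rw [← mk_curveRep q (g i), AdjoinRoot.lift_mk, curveRep_eq]
    simp [hφ]
  have hadd : (2 : ℂ) * ((h.eval x : ℝ) : ℂ) = 2 * ∑ i, ((((repA q (g i)).eval x : ℝ) : ℂ) ^ 2 -
      ((q.eval x : ℝ) : ℂ) * (((repB q (g i)).eval x : ℝ) : ℂ) ^ 2) := by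
    have hsum := congrArg₂ (· + ·) (key w hw) (key (-w) (by rw [neg_sq, hw]))
    rw [two_mul, hsum, ← Finset.sum_add_distrib, Finset.mul_sum]
    refine Finset.sum_congr rfl fun i _ => ?_
    linear_combination 2 * (((repB q (g i)).eval x : ℝ) : ℂ) ^ 2 * hw
  have := mul_left_cancel₀ (two_ne_zero) hadd
  exact_mod_cast this

lemma natDegree_repB_le_curveDelta (q : Polynomial ℝ) (f : CurveRing q) :
    (repB q f).natDegree ≤ curveDelta q f := by
  unfold curveDelta
  split_ifs with h
  · simp [h]
  · exact le_trans (Nat.le_add_left _ 2) (le_max_right _ _)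

/-- A sum of squares representation of `1 - x²` of bounded degree yields a polynomial `B` of
bounded degree that is at most `1 / (x² + ax + b)` inside `(-1, 1)` and at least this outside. -/
lemma exists_polynomial_of_isSosLe {a b : ℝ} {n : ℕ}
    (h : IsSosLe (qab a b) (AdjoinRoot.of (curvePoly (qab a b)) (1 - X ^ 2)) n) :
    ∃ B : Polynomial ℝ, B.natDegree ≤ 2 * n ∧ (∀ x, 0 ≤ B.eval x) ∧
      (∀ x, |x| < 1 → (x ^ 2 + a * x + b) * B.eval x ≤ 1) ∧
      ∀ x, 1 ≤ |x| → 1 ≤ (x ^ 2 + a * x + b) * B.eval x := by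
  generalize hq : qab a b = q at h
  obtain ⟨r, g, hg, hd⟩ := h
  let B : Polynomial ℝ := ∑ i, repB q (g i) ^ 2
  have hB : ∀ x, B.eval x = ∑ i, (repB q (g i)).eval x ^ 2 := fun x => by
    simp [B, eval_finsetSum]
  have hprod : ∀ x, 0 ≤ (1 - x ^ 2) * (1 - (x ^ 2 + a * x + b) * B.eval x) := by
    intro x
    have hx := eval_eq_of_eq_sum_sq q (1 - X ^ 2) g hg x
    rw [Finset.sum_sub_distrib, ← Finset.mul_sum, ← hB] at hx
    have hA : 0 ≤ ∑ i, (repA q (g i)).eval x ^ 2 := Finset.sum_nonneg fun i _ => sq_nonneg _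
    have hqx : q.eval x = (x ^ 2 - 1) * (x ^ 2 + a * x + b) := by simp [← hq, qab]
    rw [hqx] at hx
    simp only [eval_sub, eval_one, eval_pow, eval_X] at hx
    linarith
  have hout : ∀ x, 1 < |x| → 1 ≤ (x ^ 2 + a * x + b) * B.eval x := by
    intro x hx
    have h1 : 1 - x ^ 2 < 0 := by
      have := one_lt_sq_iff_one_lt_abs x |>.2 hx
      linarith
    have := nonpos_of_mul_nonneg_right (hprod x) h1
    linarith
  refine ⟨B, ?_, fun x => ?_, fun x hx => ?_, fun x hx => ?_⟩
  · refine natDegree_sum_le_of_forall_le _ _ fun i _ => ?_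
    refine natDegree_pow_le.trans (Nat.mul_le_mul_left 2 ?_)
    exact (natDegree_repB_le_curveDelta q (g i)).trans (hd i)
  · rw [hB]
    exact Finset.sum_nonneg fun i _ => sq_nonneg _
  · have h1 : 0 < 1 - x ^ 2 := by
      have := sq_lt_one_iff_abs_lt_one x |>.2 hx
      linarith
    have := nonneg_of_mul_nonneg_right (hprod x) h1
    linarith
  · have hc : Continuous fun t : ℝ => ((t * x) ^ 2 + a * (t * x) + b) * B.eval (t * x) := by
      fun_prop
    have hlim := (hc.tendsto 1).mono_left (nhdsWithin_le_nhds (s := Set.Ioi 1))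
    simp only [one_mul] at hlim
    refine ge_of_tendsto hlim ?_
    filter_upwards [self_mem_nhdsWithin] with t ht
    have ht : 1 < t := ht
    apply hout
    rw [abs_mul, abs_of_pos (by linarith)]
    nlinarith

/-- At a boundary point other than `(0, -1)`, the factor `x² + a₀x + b₀` has a root outside
`(-1, 1)` and takes a positive value inside. -/
lemma exists_root_and_pos_of_mem_Pbdry {a₀ b₀ : ℝ} (hbd : (a₀, b₀) ∈ Pbdry)
    (hne : (a₀, b₀) ≠ (0, -1)) :
    (∃ c : ℝ, 1 ≤ |c| ∧ c ^ 2 + a₀ * c + b₀ = 0) ∧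
      ∃ x : ℝ, |x| < 1 ∧ 0 < x ^ 2 + a₀ * x + b₀ := by
  have hb : |a₀| = b₀ + 1 → -1 < b₀ := by
    intro h
    refine lt_of_le_of_ne (by linarith [abs_nonneg a₀]) fun hb => hne ?_
    have : a₀ = 0 := abs_eq_zero.1 (by linarith)
    rw [this, ← hb]
  rcases hbd with ⟨h1, h2⟩ | ⟨h1, h2⟩
  · dsimp only at h1 h2
    refine ⟨⟨-a₀ / 2, ?_, by linarith⟩, 0, by simp, by linarith⟩
    rw [← one_le_sq_iff_one_le_abs]
    linarith
  · dsimp only at h1 h2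
    have hb := hb h1
    rcases le_total 0 a₀ with ha | ha
    · rw [abs_of_nonneg ha] at h1 h2
      refine ⟨⟨-1, by simp, by linarith⟩, (1 - b₀) / 2, ?_, ?_⟩
      · rw [abs_lt]; constructor <;> linarith
      · rw [h1]; nlinarith
    · rw [abs_of_nonpos ha] at h1 h2
      obtain rfl : a₀ = -(b₀ + 1) := by linarith
      refine ⟨⟨1, by simp, by linarith⟩, -(1 - b₀) / 2, ?_, ?_⟩
      · rw [abs_lt]; constructor <;> linarith
      · nlinarith

/-- If `θ(f) ≤ n`, then `f` is a sum of squares of elements of `δ ≤ n`. -/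
lemma isSosLe_of_curveTheta_le {q : Polynomial ℝ} {f : CurveRing q} {n : ℕ}
    (h : curveTheta q f ≤ n) : IsSosLe q f n := by
  have hlt : curveTheta q f < ((n + 1 : ℕ) : ℕ∞) :=
    h.trans_lt (by exact_mod_cast Nat.lt_succ_self n)
  obtain ⟨d, ⟨m, rfl, r, g, hg, hd⟩, hm⟩ := sInf_lt_iff.1 hlt
  have hm : m < n + 1 := by exact_mod_cast hm
  exact ⟨r, g, hg, fun i => (hd i).trans (Nat.lt_succ_iff.1 hm)⟩

/-- Corollary 4.6(b) / `boundexplode`(b): when `(a,b) ∈ P` tends to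
a boundary point of `P'` different from `(0,−1)`, the stability constant `N(a,b)`
tends to infinity. -/
theorem stability_constant_tends_to_infinity_at_boundary
    (a₀ b₀ : ℝ) (hbd : (a₀, b₀) ∈ Pbdry) (hne : (a₀, b₀) ≠ (0, -1)) :
    ∀ N : ℕ, ∃ ε > (0 : ℝ), ∀ p ∈ Pset, dist p (a₀, b₀) < ε →
      (N : ℕ∞) < Nab p.1 p.2 := by
  intro N
  obtain ⟨⟨c, hc, hc0⟩, x₀, hx₀, hpos⟩ := exists_root_and_pos_of_mem_Pbdry hbd hne
  let p : ℝ × ℝ → ℝ → ℝ := fun s x => x ^ 2 + s.1 * x + s.2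
  have hinf : {x : ℝ | |x| < 1 ∧ 0 < p (a₀, b₀) x}.Infinite := by
    have hp : Continuous (p (a₀, b₀)) := by fun_prop
    refine infinite_of_mem_nhds x₀ (IsOpen.mem_nhds ?_ ⟨hx₀, hpos⟩)
    exact (isOpen_lt continuous_abs continuous_const).inter (isOpen_lt continuous_const hp)
  obtain ⟨S, hS, hcard⟩ := hinf.exists_subset_card_eq (2 * N + 1)
  let L : ℝ → ℝ := fun x => (Lagrange.basis S id x).eval c
  let K : ℝ × ℝ → ℝ := fun s => p s c * ∑ x ∈ S, (p s x)⁻¹ * |L x|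
  have hK : ContinuousAt K (a₀, b₀) := by
    have hp : ∀ x, ContinuousAt (fun s => p s x) (a₀, b₀) := fun x =>
      Continuous.continuousAt (by fun_prop)
    refine (hp c).mul (tendsto_finsetSum S fun x hx => ?_)
    exact ((hp x).inv₀ (hS hx).2.ne').mul continuousAt_const
  have hK1 : ∀ᶠ s in nhds (a₀, b₀), K s < 1 := by
    refine hK.eventually_lt continuousAt_const ?_
    have : p (a₀, b₀) c = 0 := hc0
    simp [K, this]
  have hpS : ∀ᶠ s in nhds (a₀, b₀), ∀ x ∈ S, 0 < p s x := by
    rw [Filter.eventually_all_finset]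
    intro x hx
    exact continuousAt_const.eventually_lt
      (Continuous.continuousAt (by fun_prop)) (hS hx).2
  obtain ⟨ε, hε, H⟩ := Metric.eventually_nhds_iff.1 (hK1.and hpS)
  refine ⟨ε, hε, fun s _ hs => ?_⟩
  obtain ⟨hKs, hps⟩ := H hs
  by_contra! hle
  obtain ⟨B, hdeg, hB0, hin, hout⟩ := exists_polynomial_of_isSosLe (isSosLe_of_curveTheta_le hle)
  have hinterp : B.eval c = ∑ x ∈ S, B.eval x * L x := by
    have hlt : B.degree < S.card := by
      refine degree_le_natDegree.trans_lt ?_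
      rw [hcard]
      exact_mod_cast Nat.lt_succ_of_le hdeg
    conv_lhs => rw [Lagrange.eq_interpolate (s := S) (v := id) (Set.injOn_id _) hlt]
    simp [Lagrange.interpolate_apply, eval_finsetSum, L]
  have hbound : B.eval c ≤ ∑ x ∈ S, (p s x)⁻¹ * |L x| := by
    rw [hinterp]
    refine Finset.sum_le_sum fun x hx => ?_
    refine (mul_le_mul_of_nonneg_left (le_abs_self _) (hB0 x)).trans ?_
    refine mul_le_mul_of_nonneg_right ?_ (abs_nonneg _)
    rw [← one_div, le_div_iff₀ (hps x hx), mul_comm]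
    exact hin x (hS hx).1
  have hc1 : 1 ≤ p s c * B.eval c := hout c hc
  have hpc : 0 ≤ p s c := (pos_of_mul_pos_left (one_pos.trans_le hc1) (hB0 c)).le
  exact absurd (hc1.trans (mul_le_mul_of_nonneg_left hbound hpc)) (not_le.2 hKs)

end
end

section
/- For γ > 0 let h_γ(x) = x² + (2 + 2/γ)x + (1 + 2/γ + 4/γ²) (which equals (x + 1 + 1/γ)² + 3/γ²), and let C_γ be the real affine plane curve y² + (x² − 1)·h_γ(x) = 0. Then the stability constant N_{C_γ} = θ(1 − x²), computed in ℝ[C_γ], satisfies N_{C_γ} ≥ 2 + √γ/2. Equivalently: whenever s, t ∈ ℝ[x] are polynomials nonnegative on ℝ with 1 = t(x)·h_γ(x) − s(x)·(x² − 1), one has deg t ≥ √γ. -/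
open Polynomial

noncomputable section

/-- The quadratic `h_γ(x) = x² + (2 + 2/γ)x + (1 + 2/γ + 4/γ²)`. -/
def hGamma (γ : ℝ) : Polynomial ℝ :=
  X ^ 2 + C (2 + 2 / γ) * X + C (1 + 2 / γ + 4 / γ ^ 2)

/-- The stability constant `N_{C_γ} = θ(1 − x²)` of the curve
`y² + (x² − 1)·h_γ(x) = 0`. -/
def NGamma (γ : ℝ) : ℕ∞ :=
  curveTheta ((X ^ 2 - 1) * hGamma γ)
    (AdjoinRoot.of (curvePoly ((X ^ 2 - 1) * hGamma γ)) (1 - X ^ 2))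

namespace CurveStability

/-- The endpoint case of Markov's inequality. -/
lemma neg_derivative_eval_neg_one_le {p : ℝ[X]} {M : ℝ} (hM : 0 < M)
    (hp : ∀ x ∈ Set.Icc (-1 : ℝ) 1, 0 ≤ p.eval x ∧ p.eval x ≤ M) :
    -(derivative p).eval (-1) ≤ M / 2 * (p.natDegree : ℝ) ^ 2 := by
  set P : ℝ[X] := C (2 / M) * p.comp (-X) - 1 with hP
  have hdeg : P.degree ≤ p.natDegree := by
    refine (degree_sub_le _ _).trans (max_le ?_ ?_)
    · refine degree_le_of_natDegree_le ((natDegree_C_mul_le _ _).trans ?_)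
      simp [natDegree_comp]
    · exact degree_one_le.trans (by exact_mod_cast Nat.zero_le _)
  have hbnd : ∀ x ∈ Set.Icc (-1 : ℝ) 1, |P.eval x| ≤ 1 := by
    intro x hx
    obtain ⟨h0, h1⟩ := hp (-x) ⟨by linarith [hx.2], by linarith [hx.1]⟩
    have h2 : 2 / M * p.eval (-x) ≤ 2 := by
      rw [div_mul_eq_mul_div, div_le_iff₀ hM]
      linarith
    have h3 : 0 ≤ 2 / M * p.eval (-x) := by positivity
    simp only [hP, eval_sub, eval_mul, eval_C, eval_comp, eval_neg, eval_X, eval_one]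
    exact abs_le.2 ⟨by linarith, by linarith⟩
  have key := Chebyshev.eval_iterate_derivative_le_of_forall_abs_le_one (k := 1) (x := 1)
    le_rfl hdeg hbnd
  rw [Function.iterate_one, Chebyshev.derivative_T_eval_one] at key
  have hd : (derivative P).eval 1 = -(2 / M * (derivative p).eval (-1)) := by
    simp [hP, derivative_comp]
  rw [hd] at key
  push_cast at key
  calc -(derivative p).eval (-1) = M / 2 * -(2 / M * (derivative p).eval (-1)) := by
        field_simp
    _ ≤ M / 2 * (p.natDegree : ℝ) ^ 2 := by gcongr

lemma eval_hGamma (γ x : ℝ) :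
    (hGamma γ).eval x = x ^ 2 + (2 + 2 / γ) * x + (1 + 2 / γ + 4 / γ ^ 2) := by
  simp [hGamma]

lemma hGamma_ge {γ x : ℝ} (hγ : 0 < γ) (hx : -1 ≤ x) : 4 / γ ^ 2 ≤ (hGamma γ).eval x := by
  have h : (hGamma γ).eval x = (x + 1) ^ 2 + 2 / γ * (x + 1) + 4 / γ ^ 2 := by
    rw [eval_hGamma]; ring
  have h1 : 0 ≤ 2 / γ * (x + 1) := mul_nonneg (by positivity) (by linarith)
  nlinarith [sq_nonneg (x + 1)]

/-- The degree bound for certificates `1 = t·h_γ − s·(x² − 1)`. -/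
lemma sqrt_le_natDegree_of_certificate {γ : ℝ} (hγ : 0 < γ) {s t : ℝ[X]}
    (hs : ∀ x : ℝ, 0 ≤ s.eval x) (ht : ∀ x : ℝ, 0 ≤ t.eval x)
    (hst : (1 : ℝ[X]) = t * hGamma γ - s * (X ^ 2 - 1)) :
    Real.sqrt γ ≤ (t.natDegree : ℝ) := by
  have hev (x : ℝ) : 1 = t.eval x * (hGamma γ).eval x - s.eval x * (x ^ 2 - 1) := by
    simpa using congrArg (eval x) hst
  have hbd : ∀ x ∈ Set.Icc (-1 : ℝ) 1, 0 ≤ t.eval x ∧ t.eval x ≤ γ ^ 2 / 4 := by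
    intro x hx
    refine ⟨ht x, ?_⟩
    have h1 : 0 ≤ s.eval x * (1 - x ^ 2) :=
      mul_nonneg (hs x) (by nlinarith [hx.1, hx.2])
    have h2 : t.eval x * (4 / γ ^ 2) ≤ 1 := by
      have := mul_le_mul_of_nonneg_left (hGamma_ge hγ hx.1) (ht x)
      linarith [hev x]
    have h3 : t.eval x = t.eval x * (4 / γ ^ 2) * (γ ^ 2 / 4) := by field_simp
    rw [h3]
    exact mul_le_of_le_one_left (by positivity) h2
  have hMarkov := neg_derivative_eval_neg_one_le (by positivity) hbd
  have htm : t.eval (-1) = γ ^ 2 / 4 := by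
    have h := hev (-1)
    rw [eval_hGamma] at h
    field_simp at h ⊢
    linarith
  have hder : (derivative t).eval (-1) * (4 / γ ^ 2) + γ ^ 2 / 4 * (2 / γ) ≤ 0 := by
    have h := congrArg (fun p => (derivative p).eval (-1)) hst
    simp only [hGamma, derivative_one, derivative_sub, derivative_mul, derivative_add,
      derivative_X_pow, derivative_C, derivative_X, eval_add, eval_sub, eval_mul, eval_C, eval_X,
      eval_pow, eval_one, eval_zero, htm] at h
    norm_num at h
    have := hs (-1)
    ring_nf at h ⊢
    linarith
  have hder' : γ ^ 3 / 8 ≤ -(derivative t).eval (-1) := by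
    have h : ((derivative t).eval (-1) * (4 / γ ^ 2) + γ ^ 2 / 4 * (2 / γ)) * (γ ^ 2 / 4) ≤ 0 :=
      mul_nonpos_of_nonpos_of_nonneg hder (by positivity)
    field_simp at h
    linarith
  have hle : γ ≤ (t.natDegree : ℝ) ^ 2 := by
    have h : γ ^ 2 / 8 * γ ≤ γ ^ 2 / 8 * (t.natDegree : ℝ) ^ 2 := by linarith
    exact le_of_mul_le_mul_left h (by positivity)
  exact Real.sqrt_le_iff.2 ⟨by positivity, hle⟩

lemma curvePoly_degree (q : ℝ[X]) : (curvePoly q).degree = 2 := by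
  simpa [curvePoly] using degree_X_pow_add_C (n := 2) (by norm_num) q

lemma modByMonic_curvePoly_of_eq {q a b : ℝ[X]} {p k : ℝ[X][X]}
    (h : C a + C b * X + curvePoly q * k = p) : p %ₘ curvePoly q = C a + C b * X := by
  refine (div_modByMonic_unique k _ (curvePoly_monic q) ⟨h, ?_⟩).2
  rw [curvePoly_degree, add_comm]
  exact degree_linear_lt

lemma repA_of (q p : ℝ[X]) : repA q (AdjoinRoot.of (curvePoly q) p) = p := by
  have h : AdjoinRoot.of (curvePoly q) p = AdjoinRoot.mk (curvePoly q) (C p) :=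
    (AdjoinRoot.mk_C p).symm
  rw [repA, curveRep, h, AdjoinRoot.modByMonicHom_mk,
    modByMonic_curvePoly_of_eq (a := p) (b := 0) (k := 0) (by simp)]
  simp

lemma curveRep_eq (q : ℝ[X]) (g : CurveRing q) :
    curveRep q g = C (repA q g) + C (repB q g) * X := by
  have hdeg : (curveRep q g).degree ≤ 1 := by
    obtain ⟨p, rfl⟩ := AdjoinRoot.mk_surjective g
    rw [curveRep, AdjoinRoot.modByMonicHom_mk]
    have h := degree_modByMonic_lt p (curvePoly_monic q)
    rw [curvePoly_degree] at h
    exact Order.le_of_lt_succ h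
  rw [eq_X_add_C_of_degree_le_one hdeg]
  simp [repA, repB, curveRep, add_comm]

lemma repA_sq (q : ℝ[X]) (g : CurveRing q) :
    repA q (g ^ 2) = repA q g ^ 2 - q * repB q g ^ 2 := by
  have hg : AdjoinRoot.mk (curvePoly q) (curveRep q g) = g :=
    AdjoinRoot.mk_leftInverse (curvePoly_monic q) g
  have hsq : g ^ 2 = AdjoinRoot.mk (curvePoly q) (curveRep q g ^ 2) := by
    rw [map_pow, hg]
  conv_lhs => rw [repA, curveRep, hsq, AdjoinRoot.modByMonicHom_mk]
  rw [modByMonic_curvePoly_of_eq (a := repA q g ^ 2 - q * repB q g ^ 2)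
    (b := 2 * repA q g * repB q g) (k := C (repB q g ^ 2))]
  · rw [coeff_add, coeff_C_zero, mul_coeff_zero, coeff_X_zero, mul_zero, add_zero]
  · rw [curveRep_eq, curvePoly]
    simp only [map_sub, map_mul, map_pow, map_ofNat]
    ring

lemma repA_sum (q : ℝ[X]) {r : ℕ} (g : Fin r → CurveRing q) :
    repA q (∑ i, g i) = ∑ i, repA q (g i) := by
  simp [repA, curveRep, map_sum]

lemma X_sq_sub_one_dvd {p : ℝ[X]} (h1 : p.eval 1 = 0) (h2 : p.eval (-1) = 0) :
    (X ^ 2 - 1 : ℝ[X]) ∣ p := by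
  have hc : IsCoprime (X - C (1 : ℝ)) (X - C (-1 : ℝ)) :=
    isCoprime_X_sub_C_of_isUnit_sub (by norm_num)
  have h := hc.mul_dvd (dvd_iff_isRoot.2 h1) (dvd_iff_isRoot.2 h2)
  convert h using 1
  simp only [map_neg, map_one]
  ring

/-- A sum of squares of elements of `δ ≤ d` representing `1 − x²` on `C_γ` forces `d` to be
large. -/
lemma le_of_isSosLe {γ : ℝ} (hγ : 0 < γ) {d : ℕ}
    (h : IsSosLe ((X ^ 2 - 1) * hGamma γ)
      (AdjoinRoot.of (curvePoly ((X ^ 2 - 1) * hGamma γ)) (1 - X ^ 2)) d) :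
    2 + Real.sqrt γ / 2 ≤ (d : ℝ) := by
  generalize hq : (X ^ 2 - 1) * hGamma γ = q at h
  obtain ⟨r, g, hg, hd⟩ := h
  have hA : 1 - X ^ 2 = ∑ i, repA q (g i) ^ 2 - q * ∑ i, repB q (g i) ^ 2 := by
    have h := congrArg (repA q) hg
    rwa [repA_of, repA_sum, Finset.sum_congr rfl fun i _ => repA_sq q (g i),
      Finset.sum_sub_distrib, ← Finset.mul_sum] at h
  have hzero {x : ℝ} (hx : x ^ 2 = 1) (i : Fin r) : (repA q (g i)).eval x = 0 := by
    have h := congrArg (eval x) hA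
    simp only [← hq, eval_sub, eval_one, eval_pow, eval_X, eval_mul, eval_finsetSum, hx, sub_self,
      zero_mul, sub_zero] at h
    have := (Finset.sum_eq_zero_iff_of_nonneg fun i _ => sq_nonneg _).1 h.symm i (Finset.mem_univ i)
    exact pow_eq_zero_iff two_ne_zero |>.1 this
  choose c hc using fun i =>
    X_sq_sub_one_dvd (hzero (x := 1) (by norm_num) i) (hzero (x := -1) (by norm_num) i)
  have hne : (X ^ 2 - 1 : ℝ[X]) ≠ 0 := by
    simpa using (monic_X_pow_sub_C (1 : ℝ) two_ne_zero).ne_zero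
  have hcert : (1 : ℝ[X]) = (∑ i, repB q (g i) ^ 2) * hGamma γ
      - (∑ i, c i ^ 2) * (X ^ 2 - 1) := by
    apply mul_left_cancel₀ hne
    have hsum : ∑ i, repA q (g i) ^ 2 = (X ^ 2 - 1) ^ 2 * ∑ i, c i ^ 2 := by
      rw [Finset.mul_sum]
      exact Finset.sum_congr rfl fun i _ => by rw [hc i, mul_pow]
    rw [hsum] at hA
    linear_combination -hA + (∑ i, repB q (g i) ^ 2) * hq.symm
  have hnonneg (f : Fin r → ℝ[X]) (x : ℝ) : 0 ≤ (∑ i, f i ^ 2).eval x := by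
    rw [eval_finsetSum]
    exact Finset.sum_nonneg fun i _ => by
      rw [eval_pow]
      positivity
  have hdeg := sqrt_le_natDegree_of_certificate hγ (hnonneg c) (hnonneg fun i => repB q (g i))
    hcert
  have hpos : 0 < Real.sqrt γ := Real.sqrt_pos.2 hγ
  have hB : ∀ i, repB q (g i) ≠ 0 → 2 + (repB q (g i)).natDegree ≤ d := fun i hi => by
    have h := hd i
    rw [curveDelta, if_neg hi] at h
    exact (le_max_right _ _).trans h
  have hle : (∑ i, repB q (g i) ^ 2).natDegree ≤ 2 * (d - 2) := by
    refine natDegree_sum_le_of_forall_le _ _ fun i _ => ?_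
    rw [natDegree_pow]
    by_cases hi : repB q (g i) = 0
    · simp [hi]
    · have := hB i hi
      omega
  have hd2 : 2 ≤ d := by
    by_contra hlt
    have h0 : (∑ i, repB q (g i) ^ 2).natDegree = 0 := by omega
    rw [h0, Nat.cast_zero] at hdeg
    linarith
  have hle' : ((∑ i, repB q (g i) ^ 2).natDegree : ℝ) + 4 ≤ 2 * d := by
    have : (∑ i, repB q (g i) ^ 2).natDegree + 4 ≤ 2 * d := by omega
    exact_mod_cast this
  linarith

lemma exists_isSosLe_of_curveTheta_le {q : ℝ[X]} {f : CurveRing q} {n : ℕ}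
    (h : curveTheta q f ≤ (n : ℕ∞)) : ∃ m ≤ n, IsSosLe q f m := by
  have hne : {d : ℕ∞ | ∃ n : ℕ, d = (n : ℕ∞) ∧ IsSosLe q f n}.Nonempty := by
    by_contra hempty
    rw [curveTheta, Set.not_nonempty_iff_eq_empty.1 hempty, sInf_empty, top_le_iff] at h
    exact ENat.natCast_ne_top n h
  obtain ⟨m, hm, hsos⟩ := csInf_mem hne
  rw [curveTheta, hm] at h
  exact ⟨m, by exact_mod_cast h, hsos⟩

end CurveStability

/-- Example 4.10: for `γ > 0`, the stability constant of `C_γ`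
satisfies `N_{C_γ} ≥ 2 + √γ/2`; equivalently, every certificate
`1 = t·h_γ − s·(x²−1)` with `s, t` nonnegative on `ℝ` has `deg t ≥ √γ`. -/
theorem stability_constant_lower_bound_example
    (γ : ℝ) (hγ : 0 < γ) :
    (∀ n : ℕ, NGamma γ ≤ (n : ℕ∞) → 2 + Real.sqrt γ / 2 ≤ (n : ℝ)) ∧
    (∀ s t : Polynomial ℝ, (∀ x : ℝ, 0 ≤ s.eval x) → (∀ x : ℝ, 0 ≤ t.eval x) →
      (1 : Polynomial ℝ) = t * hGamma γ - s * (X ^ 2 - 1) →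
      Real.sqrt γ ≤ (t.natDegree : ℝ)) := by
  refine ⟨fun n hn => ?_, fun s t hs ht hst =>
    CurveStability.sqrt_le_natDegree_of_certificate hγ hs ht hst⟩
  obtain ⟨m, hmn, hm⟩ := CurveStability.exists_isSosLe_of_curveTheta_le hn
  exact (CurveStability.le_of_isSosLe hγ hm).trans (by exact_mod_cast hmn)

end
end

section
/- Let b ∈ (−1, 0) ∪ (0, ∞) and write x⁴ + Ax² + B = (x² − 1)(x² + b), i.e. A = b − 1 and B = −b. Let C(ℝ) = {(x,y) ∈ ℝ² : y² + x⁴ + Ax² + B = 0}. Then the convex hull of C(ℝ) in ℝ² equals the set of (x,y) ∈ ℝ² for which there exist real numbers u₂, u₃, u₄, v₁, v₂ such that the symmetric 4×4 matrix with rows (1, x, u₂, y), (x, u₂, u₃, v₁), (u₂, u₃, u₄, v₂), (y, v₁, v₂, −B − A·u₂ − u₄) is positive semidefinite. -/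
theorem mem_convexHull_of_rectangle {S : Set (ℝ × ℝ)} {s r : ℝ}
    (h : ({-s, s} : Set ℝ) ×ˢ ({-r, r} : Set ℝ) ⊆ S) {x y : ℝ} (hx : |x| ≤ s) (hy : |y| ≤ r) :
    (x, y) ∈ convexHull ℝ S := by
  have hs : -s ≤ s := by linarith [abs_nonneg x]
  have hr : -r ≤ r := by linarith [abs_nonneg y]
  apply convexHull_mono h
  rw [convexHull_prod, convexHull_pair, convexHull_pair, segment_eq_Icc hs, segment_eq_Icc hr]
  exact ⟨abs_le.mp hx, abs_le.mp hy⟩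

/-- Example 3.3: a lifted LMI representation of the convex hull of
the genus-one curve `y² + x⁴ + Ax² + B = 0`, where
`x⁴ + Ax² + B = (x² − 1)(x² + b)`. -/
theorem lifted_LMI_for_quartic_curve
    (b : ℝ) (hb : (-1 < b ∧ b < 0) ∨ 0 < b)
    (A B : ℝ) (hA : A = b - 1) (hB : B = -b) :
    convexHull ℝ {p : ℝ × ℝ | p.2 ^ 2 + p.1 ^ 4 + A * p.1 ^ 2 + B = 0} =
      {p : ℝ × ℝ | ∃ u₂ u₃ u₄ v₁ v₂ : ℝ,
        (Matrix.PosSemidef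
          !![1,    p.1,  u₂,  p.2;
             p.1,  u₂,   u₃,  v₁;
             u₂,   u₃,   u₄,  v₂;
             p.2,  v₁,   v₂,  -B - A * u₂ - u₄])} := by
  apply Set.Subset.antisymm
  · apply convexHull_min
    · rintro ⟨x, y⟩ h
      simp only [Set.mem_ofPred_eq] at h ⊢
      refine ⟨x ^ 2, x ^ 3, x ^ 4, x * y, x ^ 2 * y, ?_⟩
      convert Matrix.posSemidef_vecMulVec_self_star ![1, x, x ^ 2, y] using 1
      ext i j
      fin_cases i <;> fin_cases j <;> simp [Matrix.vecMulVec_apply] <;> linarith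
    · rintro ⟨x, y⟩ ⟨u₂, u₃, u₄, v₁, v₂, h⟩ ⟨x', y'⟩ ⟨u₂', u₃', u₄', v₁', v₂', h'⟩ c d hc hd hcd
      refine ⟨c * u₂ + d * u₂', c * u₃ + d * u₃', c * u₄ + d * u₄', c * v₁ + d * v₁',
        c * v₂ + d * v₂', ?_⟩
      convert (h.smul hc).add (h'.smul hd) using 1
      ext i j
      fin_cases i <;> fin_cases j <;> simp <;> first | linarith | linear_combination B * hcd
  · rintro ⟨x, y⟩ ⟨u, u₃, u₄, v₁, v₂, h⟩
    have key (a c d e : ℝ) := h.dotProduct_mulVec_nonneg ![a, c, d, e]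
    simp [Matrix.mulVec, dotProduct, Fin.sum_univ_four] at key
    have hxu : x ^ 2 ≤ u := by linarith [key (-x) 1 0 0]
    have huu : u ^ 2 ≤ u₄ := by linarith [key (-u) 0 1 0]
    have hyu : y ^ 2 ≤ -B - A * u - u₄ := by linarith [key (-y) 0 0 1]
    subst hA hB
    have hg : y ^ 2 ≤ (1 - u) * (u + b) := by linarith
    have hu : 0 ≤ u := (sq_nonneg x).trans hxu
    have hsu := Real.sq_sqrt hu
    have hsg := Real.sq_sqrt ((sq_nonneg y).trans hg)
    refine mem_convexHull_of_rectangle ?_ (Real.abs_le_sqrt hxu) (Real.abs_le_sqrt hg)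
    rintro ⟨p, q⟩ ⟨hp, hq⟩
    have hp2 : p ^ 2 = u := by
      rcases hp with rfl | rfl <;> simpa using hsu
    have hq2 : q ^ 2 = (1 - u) * (u + b) := by
      rcases hq with rfl | rfl <;> simpa using hsg
    simp only [Set.mem_ofPred_eq]
    linear_combination hq2 + (p ^ 2 + u + b - 1) * hp2
end

section
/- Let C′(ℝ) = {(x,w) ∈ ℝ² : w² = x²(1 − x⁴)} (the 'figure eight' curve, the image of the curve y² + x⁴ = 1 under (x,y) ↦ (x, xy)). Then the convex hull of C′(ℝ) in ℝ² equals the set of (x,w) ∈ ℝ² for which there exist real numbers u₂, u₃, u₄, u₅, u₆ and v₀, v₂, v₃, v₄ such that the symmetric 6×6 matrix with rows (1, x, u₂, u₃, v₀, w), (x, u₂, u₃, u₄, w, v₂), (u₂, u₃, u₄, u₅, v₂, v₃), (u₃, u₄, u₅, u₆, v₃, v₄), (v₀, w, v₂, v₃, 1 − u₄, x − u₅), (w, v₂, v₃, v₄, x − u₅, u₂ − u₆) is positive semidefinite. -/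
/-- The `2 × 2` principal minors of a real positive semidefinite matrix are nonnegative. -/
lemma Matrix.PosSemidef.mul_apply_le {n : Type*} {M : Matrix n n ℝ} (hM : M.PosSemidef)
    (i j : n) : M i j * M j i ≤ M i i * M j j := by
  have h := (hM.submatrix ![i, j]).det_nonneg
  rw [Matrix.det_fin_two] at h
  simpa using h

/-- A point in a rectangle centred at the origin is in the convex hull of any set containing
the four vertices. -/
lemma mem_convexHull_of_abs_le {S : Set (ℝ × ℝ)} {a b : ℝ}
    (hS : ({-a, a} : Set ℝ) ×ˢ ({-b, b} : Set ℝ) ⊆ S) {p : ℝ × ℝ}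
    (h₁ : |p.1| ≤ a) (h₂ : |p.2| ≤ b) : p ∈ convexHull ℝ S := by
  apply convexHull_mono hS
  have ha : -a ≤ a := neg_le_self ((abs_nonneg _).trans h₁)
  have hb : -b ≤ b := neg_le_self ((abs_nonneg _).trans h₂)
  rw [convexHull_prod, convexHull_pair, convexHull_pair, segment_eq_Icc ha, segment_eq_Icc hb]
  exact ⟨abs_le.mp h₁, abs_le.mp h₂⟩

/-- Every point of the figure eight lifts to the curve `y² + x⁴ = 1` via `w = x * y`. -/
lemma exists_lift_of_figure_eight {x w : ℝ} (h : w ^ 2 = x ^ 2 * (1 - x ^ 4)) :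
    ∃ y : ℝ, w = x * y ∧ y ^ 2 = 1 - x ^ 4 := by
  rcases eq_or_ne x 0 with rfl | hx
  · exact ⟨1, by simpa using h, by norm_num⟩
  · refine ⟨w / x, by field_simp, ?_⟩
    rw [div_pow, h]
    field_simp

/-- Example 3.4: a lifted LMI representation of the convex hull of
the "figure eight" curve `w² = x²(1 − x⁴)`. -/
theorem lifted_LMI_for_figure_eight
    :
    convexHull ℝ {p : ℝ × ℝ | p.2 ^ 2 = p.1 ^ 2 * (1 - p.1 ^ 4)} =
      {p : ℝ × ℝ | ∃ u₂ u₃ u₄ u₅ u₆ v₀ v₂ v₃ v₄ : ℝ,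
        (Matrix.PosSemidef
          !![1,    p.1,  u₂,   u₃,   v₀,        p.2;
             p.1,  u₂,   u₃,   u₄,   p.2,       v₂;
             u₂,   u₃,   u₄,   u₅,   v₂,        v₃;
             u₃,   u₄,   u₅,   u₆,   v₃,        v₄;
             v₀,   p.2,  v₂,   v₃,   1 - u₄,    p.1 - u₅;
             p.2,  v₂,   v₃,   v₄,   p.1 - u₅,  u₂ - u₆])} := by
  apply Set.Subset.antisymm
  · refine convexHull_min ?_ ?_
    · rintro ⟨x, w⟩ h
      obtain ⟨y, rfl, hy⟩ := exists_lift_of_figure_eight (x := x) (w := w) h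
      refine ⟨x ^ 2, x ^ 3, x ^ 4, x ^ 5, x ^ 6, y, x ^ 2 * y, x ^ 3 * y, x ^ 4 * y, ?_⟩
      convert Matrix.posSemidef_vecMulVec_self_star ![1, x, x ^ 2, x ^ 3, y, x * y] using 1
      ext i j
      fin_cases i <;> fin_cases j <;> simp [Matrix.vecMulVec_apply] <;> grind
    · rintro ⟨x, w⟩ ⟨u₂, u₃, u₄, u₅, u₆, v₀, v₂, v₃, v₄, h⟩
        ⟨x', w'⟩ ⟨u₂', u₃', u₄', u₅', u₆', v₀', v₂', v₃', v₄', h'⟩ a b ha hb hab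
      refine ⟨a * u₂ + b * u₂', a * u₃ + b * u₃', a * u₄ + b * u₄', a * u₅ + b * u₅',
        a * u₆ + b * u₆', a * v₀ + b * v₀', a * v₂ + b * v₂', a * v₃ + b * v₃',
        a * v₄ + b * v₄', ?_⟩
      convert (h.smul ha).add (h'.smul hb) using 1
      ext i j
      fin_cases i <;> fin_cases j <;> simp <;> linarith
  · rintro ⟨x, w⟩ ⟨u₂, u₃, u₄, u₅, u₆, v₀, v₂, v₃, v₄, h⟩
    have hx : x * x ≤ u₂ := by simpa using h.mul_apply_le 0 1
    have hu : u₂ * u₂ ≤ u₄ := by simpa using h.mul_apply_le 0 2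
    have hw : w * w ≤ u₂ * (1 - u₄) := by simpa using h.mul_apply_le 1 4
    have hu₂ : 0 ≤ u₂ := (mul_self_nonneg x).trans hx
    have hw' : w ^ 2 ≤ u₂ * (1 - u₂ ^ 2) := by nlinarith
    have ha := Real.sq_sqrt hu₂
    have hb := Real.sq_sqrt ((sq_nonneg w).trans hw')
    refine mem_convexHull_of_abs_le (a := √u₂) (b := √(u₂ * (1 - u₂ ^ 2))) ?_
      (Real.abs_le_sqrt (by simpa [sq] using hx)) (Real.abs_le_sqrt hw')
    rintro ⟨p, q⟩ ⟨hp, hq⟩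
    have hp' : p ^ 2 = u₂ := by rcases hp with rfl | rfl <;> simpa using ha
    have hq' : q ^ 2 = u₂ * (1 - u₂ ^ 2) := by rcases hq with rfl | rfl <;> simpa using hb
    change q ^ 2 = p ^ 2 * (1 - p ^ 4)
    rw [hq', ← hp']
    ring
end
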